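/- The cevians through the vertices of the first Brocard triangle, i.e., the lines AA₁, BB₁, CC₁ where A₁B₁C₁ is the first Brocard triangle of ABC, are the isotomic conjugate cevians of the symmedians AA₂, BB₂, CC₂ of the triangle ABC; in particular AA₁ meets BC at the reflection of the symmedian foot A₂ in the midpoint of BC. -/

import Mathlib

open EuclideanGeometry Real Affine
open scoped RealInnerProductSpace

noncomputable section

abbrev Pt := EuclideanSpace ℝ (Fin 2)

section Brocard

variable {V : Type*} [NormedAddCommGroup V] [InnerProductSpace ℝ V] {A B C K A₁ A₂ : V}

/-- The vertex `A₁` of the first Brocard triangle, in barycentric form. -/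
theorem firstBrocard_vertex_smul_sub (hBC : B ≠ C)
    (hK : (dist B C) ^ 2 • (A - K) + (dist C A) ^ 2 • (B - K) + (dist A B) ^ 2 • (C - K) = 0)
    (hA₁ : A₁ ∈ AffineSubspace.perpBisector B C) (hA₁p : ∃ t : ℝ, K - A₁ = t • (B - C)) :
    ((dist B C) ^ 2 + (dist C A) ^ 2 + (dist A B) ^ 2) • (A₁ - A) =
      (dist A B) ^ 2 • (B - A) + (dist C A) ^ 2 • (C - A) := by
  obtain ⟨t, ht⟩ := hA₁p
  have ha : dist B C ^ 2 ≠ 0 := pow_ne_zero 2 (dist_ne_zero.mpr hBC)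
  obtain ⟨u, rfl⟩ : ∃ u, B = A + u := ⟨B - A, by abel⟩
  obtain ⟨v, rfl⟩ : ∃ v, C = A + v := ⟨C - A, by abel⟩
  obtain ⟨w, rfl⟩ : ∃ w, A₁ = A + w := ⟨A₁ - A, by abel⟩
  obtain rfl : K = A + w + t • (u - v) := by
    rw [sub_eq_iff_eq_add] at ht
    rw [ht]
    module
  have hb : dist (A + v) A ^ 2 = ⟪v, v⟫ := by
    rw [dist_eq_norm, real_inner_self_eq_norm_sq]; simp
  have hc : dist A (A + u) ^ 2 = ⟪u, u⟫ := by
    rw [dist_comm, dist_eq_norm, real_inner_self_eq_norm_sq]; simp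
  have ha' : dist (A + u) (A + v) ^ 2 = ⟪u, u⟫ - 2 * ⟪u, v⟫ + ⟪v, v⟫ := by
    rw [dist_add_left, dist_eq_norm, ← real_inner_self_eq_norm_sq, real_inner_sub_sub_self]
  have hperp : 2 * (⟪w, u⟫ - ⟪w, v⟫) = ⟪u, u⟫ - ⟪v, v⟫ := by
    rw [AffineSubspace.mem_perpBisector_iff_dist_eq, dist_add_left, dist_add_left] at hA₁
    have h := congrArg (fun x : ℝ => x ^ 2) hA₁
    simp only [dist_eq_norm, ← real_inner_self_eq_norm_sq, real_inner_sub_sub_self] at h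
    linarith
  rw [ha'] at ha
  rw [hb, hc, ha'] at hK ⊢
  set p := ⟪u, u⟫
  set q := ⟪v, v⟫
  set r := ⟪u, v⟫
  have hw : (p - 2 * r + q + q + p) • w =
      (q - (p - 2 * r + q + q + p) * t) • u + (p + (p - 2 * r + q + q + p) * t) • v := by
    rw [← sub_eq_zero, ← neg_eq_zero, ← hK]
    module
  have hτ : (p - 2 * r + q + q + p) * t = q - p := by
    have h := congrArg (fun x => ⟪x, u - v⟫) hw
    simp only [inner_add_left, inner_smul_left, inner_sub_right, conj_trivial] at h
    rw [real_inner_comm u v] at h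
    apply mul_left_cancel₀ ha
    simp only [← show p = ⟪u, u⟫ from rfl, ← show q = ⟪v, v⟫ from rfl,
      ← show r = ⟪u, v⟫ from rfl] at h
    linear_combination h - (p - 2 * r + q + q + p) / 2 * hperp
  rw [hτ] at hw
  simp only [add_sub_cancel_left]
  rw [hw]
  module

/-- The foot of the symmedian from `A`, in barycentric form. -/
theorem symmedian_foot_eq_lineMap (hAB : A ≠ B) (hBC : B ≠ C) (hCA : C ≠ A)
    (hA₂ : A₂ ∈ openSegment ℝ B C)
    (hA₂r : dist B A₂ / dist A₂ C = (dist A B) ^ 2 / (dist C A) ^ 2) :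
    A₂ = AffineMap.lineMap B C ((dist A B) ^ 2 / ((dist C A) ^ 2 + (dist A B) ^ 2)) := by
  rw [openSegment_eq_image_lineMap] at hA₂
  obtain ⟨s, ⟨hs0, hs1⟩, rfl⟩ := hA₂
  have hb := dist_pos.mpr hCA
  have hc := dist_pos.mpr hAB
  have ha := dist_pos.mpr hBC
  have hs1' : 0 < 1 - s := sub_pos.mpr hs1
  rw [dist_left_lineMap, dist_lineMap_right, Real.norm_of_nonneg hs0.le,
    Real.norm_of_nonneg hs1'.le, div_eq_div_iff (by positivity) (by positivity)] at hA₂r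
  congr 1
  rw [eq_div_iff (by positivity)]
  apply mul_left_cancel₀ ha.ne'
  linear_combination hA₂r

/-- The reflection of the foot of the symmedian from `A` in the midpoint of `BC` lies on the
cevian through the vertex `A₁` of the first Brocard triangle. -/
theorem pointReflection_symmedian_foot_mem_line (hAB : A ≠ B) (hBC : B ≠ C) (hCA : C ≠ A)
    (hK : (dist B C) ^ 2 • (A - K) + (dist C A) ^ 2 • (B - K) + (dist A B) ^ 2 • (C - K) = 0)
    (hA₁ : A₁ ∈ AffineSubspace.perpBisector B C) (hA₁p : ∃ t : ℝ, K - A₁ = t • (B - C))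
    (hA₂ : A₂ ∈ openSegment ℝ B C)
    (hA₂r : dist B A₂ / dist A₂ C = (dist A B) ^ 2 / (dist C A) ^ 2) :
    Equiv.pointReflection (midpoint ℝ B C) A₂ ∈ line[ℝ, A, A₁] := by
  have hb := dist_pos.mpr hCA
  have hc := dist_pos.mpr hAB
  have hne : (dist C A) ^ 2 + (dist A B) ^ 2 ≠ 0 := by positivity
  have h₁ := firstBrocard_vertex_smul_sub hBC hK hA₁ hA₁p
  rw [symmedian_foot_eq_lineMap hAB hBC hCA hA₂ hA₂r]
  convert AffineMap.lineMap_mem_affineSpan_pair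
    (((dist B C) ^ 2 + (dist C A) ^ 2 + (dist A B) ^ 2) / ((dist C A) ^ 2 + (dist A B) ^ 2)) A A₁
    using 1
  rw [AffineMap.lineMap_apply_module' A, div_eq_inv_mul (_ + _ + _), mul_smul, h₁,
    Equiv.pointReflection_apply, AffineMap.lineMap_apply_module', midpoint_eq_smul_add]
  simp only [vsub_eq_sub, vadd_eq_add, invOf_eq_inv]
  match_scalars <;> field_simp <;> ring

end Brocard

/-- The cevians `AA₁, BB₁, CC₁` through the vertices of the first Brocard triangle
`A₁B₁C₁` are the isotomic conjugates of the symmedians: the reflection of the symmedian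
foot in the midpoint of the corresponding side lies on the corresponding cevian. -/
theorem stmt_9 (A B C K A₁ B₁ C₁ A₂ B₂ C₂ : Pt)
    (hABC : AffineIndependent ℝ ![A, B, C])
    (hK : (dist B C) ^ 2 • (A -ᵥ K) + (dist C A) ^ 2 • (B -ᵥ K) + (dist A B) ^ 2 • (C -ᵥ K)
          = (0 : Pt))
    (hA₁ : A₁ ∈ AffineSubspace.perpBisector B C) (hA₁p : ∃ t : ℝ, K -ᵥ A₁ = t • (B -ᵥ C))
    (hB₁ : B₁ ∈ AffineSubspace.perpBisector C A) (hB₁p : ∃ t : ℝ, K -ᵥ B₁ = t • (C -ᵥ A))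
    (hC₁ : C₁ ∈ AffineSubspace.perpBisector A B) (hC₁p : ∃ t : ℝ, K -ᵥ C₁ = t • (A -ᵥ B))
    (hA₂ : A₂ ∈ openSegment ℝ B C)
    (hA₂r : dist B A₂ / dist A₂ C = (dist A B) ^ 2 / (dist C A) ^ 2)
    (hB₂ : B₂ ∈ openSegment ℝ C A)
    (hB₂r : dist C B₂ / dist B₂ A = (dist B C) ^ 2 / (dist A B) ^ 2)
    (hC₂ : C₂ ∈ openSegment ℝ A B)
    (hC₂r : dist A C₂ / dist C₂ B = (dist C A) ^ 2 / (dist B C) ^ 2) :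
    Equiv.pointReflection (midpoint ℝ B C) A₂ ∈ line[ℝ, A, A₁] ∧
    Equiv.pointReflection (midpoint ℝ C A) B₂ ∈ line[ℝ, B, B₁] ∧
    Equiv.pointReflection (midpoint ℝ A B) C₂ ∈ line[ℝ, C, C₁] := by
  have hAB : A ≠ B := hABC.injective.ne (show (0 : Fin 3) ≠ 1 by decide)
  have hBC : B ≠ C := hABC.injective.ne (show (1 : Fin 3) ≠ 2 by decide)
  have hCA : C ≠ A := hABC.injective.ne (show (2 : Fin 3) ≠ 0 by decide)
  simp only [vsub_eq_sub] at hK hA₁p hB₁p hC₁p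
  exact ⟨pointReflection_symmedian_foot_mem_line hAB hBC hCA hK hA₁ hA₁p hA₂ hA₂r,
    pointReflection_symmedian_foot_mem_line hBC hCA hAB (by rw [← hK]; abel) hB₁ hB₁p hB₂ hB₂r,
    pointReflection_symmedian_foot_mem_line hCA hAB hBC (by rw [← hK]; abel) hC₁ hC₁p hC₂ hC₂r⟩
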